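/- Assume the family {P^u}_{u∈(a,b)} satisfies P1–P3 and S1–S2. Then for each u ∈ (a,b) there exist c > 0 and C < ∞ such that for all R ≥ 1 and all e ∈ Z^d with |e|₁ = 1: P^u[k·e ∈ S_∞ for some integer 0 ≤ k ≤ R] ≥ 1 − C·e^{−c(log R)^{1+Δ_S}} (i.e., P^u satisfies assumption A3 with Δ₃ = Δ_S). -/

import Mathlib

open MeasureTheory Filter
open scoped ENNReal

namespace Perco

/-- A point of the lattice `ℤ^d`. -/
abbrev Pt (d : ℕ) := Fin d → ℤ

/-- A percolation configuration on `ℤ^d`. -/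
abbrev Config (d : ℕ) := Pt d → Bool

variable {d : ℕ}

/-- The `ℓ¹`-distance on `ℤ^d`. -/
def dist1 (x y : Pt d) : ℕ := ∑ i, (x i - y i).natAbs

/-- The `ℓ^∞`-distance on `ℤ^d`. -/
def distInf (x y : Pt d) : ℕ := Finset.univ.sup fun i => (x i - y i).natAbs

/-- The closed `ℓ^∞`-ball of radius `R` around `x`. -/
def ballZ (x : Pt d) (R : ℕ) : Set (Pt d) := {y | distInf x y ≤ R}

/-- Nearest-neighbour adjacency in `ℤ^d`. -/
def adj (x y : Pt d) : Prop := dist1 x y = 1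

/-- The occupied set of a configuration. -/
def SS (ω : Config d) : Set (Pt d) := {x | ω x = true}

/-- One step of a nearest-neighbour path staying inside `T`. -/
def stepRel (T : Set (Pt d)) (x y : Pt d) : Prop := adj x y ∧ x ∈ T ∧ y ∈ T

/-- `x` and `y` are connected by a nearest-neighbour path inside `T`. -/
def connIn (T : Set (Pt d)) (x y : Pt d) : Prop :=
  x ∈ T ∧ y ∈ T ∧ Relation.ReflTransGen (stepRel T) x y

/-- The connected component (cluster) of `x` in `T`. -/
def cluster (T : Set (Pt d)) (x : Pt d) : Set (Pt d) := {y | connIn T x y}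

/-- `S_r`: vertices of `S(ω)` in connected components of `ℓ¹`-diameter at least `r`. -/
def Sr (ω : Config d) (r : ℝ) : Set (Pt d) :=
  {x | x ∈ SS ω ∧ ∃ y ∈ cluster (SS ω) x, ∃ z ∈ cluster (SS ω) x, r ≤ (dist1 y z : ℝ)}

/-- `S_∞`: vertices of `S(ω)` in infinite connected components. -/
def Sinf (ω : Config d) : Set (Pt d) := {x | x ∈ SS ω ∧ (cluster (SS ω) x).Infinite}

/-- The shift of a configuration by `x`. -/
def shift (x : Pt d) (ω : Config d) : Config d := fun y => ω (x + y)

/-- An increasing event. -/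
def IncreasingEvent (G : Set (Config d)) : Prop :=
  ∀ ω ω' : Config d, (∀ x, ω x = true → ω' x = true) → ω ∈ G → ω' ∈ G

/-- A decreasing event. -/
def DecreasingEvent (G : Set (Config d)) : Prop :=
  ∀ ω ω' : Config d, (∀ x, ω' x = true → ω x = true) → ω ∈ G → ω' ∈ G

/-- The event `G` depends only on the coordinates in `B`. -/
def DependsOn (G : Set (Config d)) (B : Set (Pt d)) : Prop :=
  ∀ ω ω' : Config d, (∀ x ∈ B, ω x = ω' x) → (ω ∈ G ↔ ω' ∈ G)

/-- The edge boundary of `A` in `Sset`: (directed representatives of) edges of `ℤ^d`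
with one endpoint in `A` and the other in `Sset \ A`. -/
def edgeBd (Sset A : Set (Pt d)) : Set (Pt d × Pt d) :=
  {p | adj p.1 p.2 ∧ p.1 ∈ A ∧ p.2 ∈ Sset \ A}

/-- The density `η(u) = P[0 ∈ S_∞]` of the infinite cluster. -/
noncomputable def eta (d : ℕ) (P : Measure (Config d)) : ℝ :=
  (P {ω | (0 : Pt d) ∈ Sinf ω}).toReal

/-- The first local-uniqueness event of axiom S1. -/
def locUniq1 (d : ℕ) (R : ℕ) : Set (Config d) :=
  {ω | (Sr ω R ∩ ballZ (0 : Pt d) R).Nonempty}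

/-- The second local-uniqueness event of axiom S1. -/
def locUniq2 (d : ℕ) (R : ℕ) : Set (Config d) :=
  {ω | ∀ x ∈ Sr ω ((R : ℝ)/10) ∩ ballZ (0 : Pt d) R,
       ∀ y ∈ Sr ω ((R : ℝ)/10) ∩ ballZ (0 : Pt d) R,
       connIn (SS ω ∩ ballZ (0 : Pt d) (2*R)) x y}

/-- The axioms **P1**–**P3** and **S1**–**S2** of Drewitz–Ráth–Sapozhnikov for a
one-parameter family of probability measures on `{0,1}^{ℤ^d}`. -/
structure Axioms (d : ℕ) (a b : ℝ) (P : ℝ → Measure (Config d)) where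
  /-- decoupling exponent -/
  εP : ℝ
  /-- sprinkling exponent -/
  χP : ℝ
  RP : ℕ
  LP : ℕ
  fP : ℕ → ℝ
  fS : ℝ → ℕ → ℝ
  ΔS : ℝ → ℝ
  RS : ℝ → ℕ
  prob : ∀ u ∈ Set.Ioo a b, IsProbabilityMeasure (P u)
  /-- P1: every lattice shift is measure preserving and ergodic. -/
  ergodic : ∀ u ∈ Set.Ioo a b, ∀ x : Pt d, x ≠ 0 → Ergodic (shift x) (P u)
  /-- P2: monotonicity. -/
  mono : ∀ u ∈ Set.Ioo a b, ∀ u' ∈ Set.Ioo a b, u ≤ u' →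
    ∀ G : Set (Config d), MeasurableSet G → IncreasingEvent G → P u G ≤ P u' G
  εP_pos : 0 < εP
  χP_pos : 0 < χP
  fP_lb : ∀ L : ℕ, LP ≤ L → Real.exp ((Real.log L) ^ εP) ≤ fP L
  /-- P3, decoupling for decreasing events. -/
  decoupleDec : ∀ (R L : ℕ), RP ≤ R → 1 ≤ L → ∀ x₁ x₂ : Pt d, R * L ≤ distInf x₁ x₂ →
    ∀ u uh : ℝ, uh ∈ Set.Ioo a b → u ∈ Set.Ioo a b → uh < u →
    (1 + (R : ℝ) ^ (-χP)) * uh ≤ u →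
    ∀ A₁ A₂ : Set (Config d), MeasurableSet A₁ → MeasurableSet A₂ →
      DecreasingEvent A₁ → DecreasingEvent A₂ →
      DependsOn A₁ (ballZ x₁ (10*L)) → DependsOn A₂ (ballZ x₂ (10*L)) →
      (P u (A₁ ∩ A₂)).toReal ≤ (P uh A₁).toReal * (P uh A₂).toReal + Real.exp (-(fP L))
  /-- P3, decoupling for increasing events. -/
  decoupleInc : ∀ (R L : ℕ), RP ≤ R → 1 ≤ L → ∀ x₁ x₂ : Pt d, R * L ≤ distInf x₁ x₂ →
    ∀ u uh : ℝ, uh ∈ Set.Ioo a b → u ∈ Set.Ioo a b → uh < u →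
    (1 + (R : ℝ) ^ (-χP)) * uh ≤ u →
    ∀ B₁ B₂ : Set (Config d), MeasurableSet B₁ → MeasurableSet B₂ →
      IncreasingEvent B₁ → IncreasingEvent B₂ →
      DependsOn B₁ (ballZ x₁ (10*L)) → DependsOn B₂ (ballZ x₂ (10*L)) →
      (P uh (B₁ ∩ B₂)).toReal ≤ (P u B₁).toReal * (P u B₂).toReal + Real.exp (-(fP L))
  ΔS_pos : ∀ u ∈ Set.Ioo a b, 0 < ΔS u
  fS_lb : ∀ u ∈ Set.Ioo a b, ∀ R : ℕ, RS u ≤ R → (Real.log R) ^ (1 + ΔS u) ≤ fS u R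
  /-- S1, first part. -/
  S1a : ∀ u ∈ Set.Ioo a b, ∀ R : ℕ, 1 ≤ R →
    1 - Real.exp (-(fS u R)) ≤ (P u (locUniq1 d R)).toReal
  /-- S1, second part. -/
  S1b : ∀ u ∈ Set.Ioo a b, ∀ R : ℕ, 1 ≤ R →
    1 - Real.exp (-(fS u R)) ≤ (P u (locUniq2 d R)).toReal
  /-- S2: positivity of the density of the infinite cluster. -/
  S2pos : ∀ u ∈ Set.Ioo a b, 0 < eta d (P u)
  /-- S2: continuity of the density of the infinite cluster. -/
  S2cont : ContinuousOn (fun u => eta d (P u)) (Set.Ioo a b)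



/-! ### Basic distance facts -/

lemma distInf_le_iff (x y : Pt d) (R : ℕ) : distInf x y ≤ R ↔ ∀ i, (x i - y i).natAbs ≤ R := by
  simp [distInf, Finset.sup_le_iff]

lemma distInf_le_dist1 (x y : Pt d) : distInf x y ≤ dist1 x y := by
  rw [distInf_le_iff]
  intro i
  exact Finset.single_le_sum (f := fun i => (x i - y i).natAbs) (fun _ _ => Nat.zero_le _)
    (Finset.mem_univ i)

lemma distInf_triangle (x y z : Pt d) : distInf x z ≤ distInf x y + distInf y z := by
  rw [distInf_le_iff]
  intro i
  have h1 := (distInf_le_iff x y _).1 le_rfl i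
  have h2 := (distInf_le_iff y z _).1 le_rfl i
  omega

lemma ballZ_finite (x : Pt d) (R : ℕ) : (ballZ x R).Finite := by
  have : ballZ x R ⊆ Set.Icc (fun i => x i - R) (fun i => x i + R) := by
    intro y hy
    have h := (distInf_le_iff x y R).1 hy
    constructor
    · intro i
      have := h i
      simp only
      omega
    · intro i
      have := h i
      simp only
      omega
  exact (Set.finite_Icc _ _).subset this

lemma distInf_shift_le (x e : Pt d) (he : dist1 (0 : Pt d) e = 1) (D : ℕ) :
    distInf x (x + (D : ℤ) • e) ≤ D := by
  rw [distInf_le_iff]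
  intro i
  have h1 := (distInf_le_iff 0 e _).1 ((distInf_le_dist1 0 e).trans he.le) i
  simp only [Pi.zero_apply, zero_sub, Int.natAbs_neg] at h1
  simp only [Pi.add_apply, Pi.smul_apply, smul_eq_mul, sub_add_cancel_left, Int.natAbs_neg,
    Int.natAbs_mul, Int.natAbs_natCast]
  nlinarith

lemma le_distInf_shift (x e : Pt d) (he : dist1 (0 : Pt d) e = 1) (D : ℕ) :
    D ≤ distInf x (x + (D : ℤ) • e) := by
  have : ∃ i, 1 ≤ (e i).natAbs := by
    by_contra! h
    have : dist1 (0 : Pt d) e = 0 := by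
      unfold dist1
      apply Finset.sum_eq_zero
      intro i _
      have := h i
      simp only [Pi.zero_apply]
      omega
    omega
  obtain ⟨i, hi⟩ := this
  have h := (distInf_le_iff x (x + (D : ℤ) • e) _).1 le_rfl i
  simp only [Pi.add_apply, Pi.smul_apply, smul_eq_mul, sub_add_cancel_left, Int.natAbs_neg,
    Int.natAbs_mul, Int.natAbs_natCast] at h
  nlinarith

/-! ### Connectivity -/

lemma stepRel_symm {T : Set (Pt d)} {x y : Pt d} (h : stepRel T x y) : stepRel T y x := by
  refine ⟨?_, h.2.2, h.2.1⟩
  have := h.1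
  unfold adj dist1 at *
  rw [← this]
  apply Finset.sum_congr rfl
  intro i _
  omega

lemma connIn_symm {T : Set (Pt d)} {x y : Pt d} (h : connIn T x y) : connIn T y x := by
  refine ⟨h.2.1, h.1, ?_⟩
  have := h.2.2
  induction this with
  | refl => exact .refl
  | tail _ hs ih => exact Relation.ReflTransGen.head (stepRel_symm hs) (ih ⟨h.1, hs.2.1, by assumption⟩)

lemma connIn_trans {T : Set (Pt d)} {x y z : Pt d} (h : connIn T x y) (h' : connIn T y z) :
    connIn T x z := ⟨h.1, h'.2.1, h.2.2.trans h'.2.2⟩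

lemma connIn_mono {T T' : Set (Pt d)} (hT : T ⊆ T') {x y : Pt d} (h : connIn T x y) :
    connIn T' x y :=
  ⟨hT h.1, hT h.2.1, Relation.ReflTransGen.mono (fun _ _ s => ⟨s.1, hT s.2.1, hT s.2.2⟩) _ _ h.2.2⟩

/-- `n`-step reachability. -/
def reachN (T : Set (Pt d)) : ℕ → Pt d → Pt d → Prop
  | 0, x, y => x = y
  | n + 1, x, y => ∃ z, reachN T n x z ∧ stepRel T z y

lemma reachN_iff (T : Set (Pt d)) (x y : Pt d) :
    Relation.ReflTransGen (stepRel T) x y ↔ ∃ n, reachN T n x y := by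
  constructor
  · intro h
    induction h with
    | refl => exact ⟨0, rfl⟩
    | tail _ hs ih =>
      obtain ⟨n, hn⟩ := ih
      exact ⟨n + 1, _, hn, hs⟩
  · rintro ⟨n, hn⟩
    induction n generalizing y with
    | zero => rw [show x = y from hn]
    | succ n ih =>
      obtain ⟨z, hz, hs⟩ := hn
      exact (ih z hz).tail hs

lemma meas_mem (B : Set (Pt d)) (x : Pt d) :
    Measurable (fun ω : Config d => x ∈ SS ω ∩ B) := by
  have h1 : Measurable (fun ω : Config d => x ∈ SS ω) := by
    have : MeasurableSet {ω : Config d | ω x = true} :=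
      (measurable_pi_apply (X := fun _ : Pt d => Bool) x) (measurableSet_singleton true)
    exact measurableSet_setOfPred.1 this
  exact h1.and measurable_const

lemma meas_reachN (B : Set (Pt d)) (n : ℕ) (x y : Pt d) :
    Measurable (fun ω : Config d => reachN (SS ω ∩ B) n x y) := by
  induction n generalizing y with
  | zero => exact measurable_const
  | succ n ih =>
    refine Measurable.exists fun z => (ih z).and ?_
    exact Measurable.and measurable_const ((meas_mem B z).and (meas_mem B y))

lemma meas_connIn (B : Set (Pt d)) (x y : Pt d) :
    Measurable (fun ω : Config d => connIn (SS ω ∩ B) x y) := by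
  unfold connIn
  simp_rw [reachN_iff]
  exact (meas_mem B x).and ((meas_mem B y).and (Measurable.exists fun n => meas_reachN B n x y))

lemma meas_Sr (r : ℝ) (x : Pt d) : Measurable (fun ω : Config d => x ∈ Sr ω r) := by
  have h : ∀ ω : Config d, SS ω = SS ω ∩ Set.univ := fun ω => (Set.inter_univ _).symm
  have hm : ∀ y, Measurable (fun ω : Config d => y ∈ cluster (SS ω) x) := by
    intro y
    have := meas_connIn Set.univ x y
    simp only [← h] at this
    exact this
  have hx : Measurable (fun ω : Config d => x ∈ SS ω) := by
    have := meas_mem Set.univ x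
    simpa only [← h] using this
  exact hx.and (Measurable.exists fun y => (hm y).and (Measurable.exists fun z =>
    (hm z).and measurable_const))

lemma meas_locUniq1 (R : ℕ) : MeasurableSet (locUniq1 d R) := by
  apply measurableSet_setOfPred.2
  exact Measurable.exists fun y => (meas_Sr _ y).and measurable_const

lemma meas_locUniq2 (R : ℕ) : MeasurableSet (locUniq2 d R) := by
  apply measurableSet_setOfPred.2
  exact Measurable.forall fun x => Measurable.imp ((meas_Sr _ x).and measurable_const)
    (Measurable.forall fun y => Measurable.imp ((meas_Sr _ y).and measurable_const)
      (meas_connIn _ x y))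

lemma meas_shift (x : Pt d) : Measurable (shift x : Config d → Config d) :=
  measurable_pi_lambda _ fun y => measurable_pi_apply (x + y)

/-! ### The local non-connection event -/

/-- The origin is not connected to distance `L` inside the ball of radius `L`. -/
def badLoc (d L : ℕ) : Set (Config d) :=
  {ω | ∀ y, connIn (SS ω ∩ ballZ (0 : Pt d) L) 0 y → distInf 0 y < L}

lemma meas_badLoc (L : ℕ) : MeasurableSet (badLoc d L) := by
  apply measurableSet_setOfPred.2
  exact Measurable.forall fun y => Measurable.imp (meas_connIn _ 0 y) measurable_const

lemma dec_badLoc (L : ℕ) : DecreasingEvent (badLoc d L) := by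
  intro ω ω' h hω y hy
  exact hω y (connIn_mono (Set.inter_subset_inter_left _ (fun x hx => h x hx)) hy)

lemma dep_badLoc (L : ℕ) : DependsOn (badLoc d L) (ballZ 0 L) := by
  intro ω ω' h
  have : SS ω ∩ ballZ (0 : Pt d) L = SS ω' ∩ ballZ (0 : Pt d) L := by
    ext x
    simp only [Set.mem_inter_iff, SS, Set.mem_ofPred_eq]
    constructor
    · rintro ⟨h1, h2⟩; exact ⟨by rw [← h x h2]; exact h1, h2⟩
    · rintro ⟨h1, h2⟩; exact ⟨by rw [h x h2]; exact h1, h2⟩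
  simp only [badLoc, Set.mem_ofPred_eq, this]

lemma badLoc_not_Sinf {L : ℕ} {ω : Config d} (h : ω ∈ badLoc d L) : (0 : Pt d) ∉ Sinf ω := by
  rintro ⟨h0, hinf⟩
  apply hinf
  apply (ballZ_finite (0 : Pt d) L).subset
  have hz : (0 : Pt d) ∈ SS ω ∩ ballZ (0 : Pt d) L := by
    refine ⟨h0, ?_⟩
    simp [ballZ, distInf]
  suffices H : ∀ y, Relation.ReflTransGen (stepRel (SS ω)) 0 y →
      connIn (SS ω ∩ ballZ (0 : Pt d) L) 0 y by
    intro y hy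
    exact (H y hy.2.2).2.1.2
  intro y hy
  induction hy with
  | refl => exact ⟨hz, hz, .refl⟩
  | @tail b c _ hs ih =>
    have hb := h b ih
    have hc : c ∈ SS ω ∩ ballZ (0 : Pt d) L := by
      refine ⟨hs.2.2, ?_⟩
      have h1 := distInf_triangle 0 b c
      have h2 := distInf_le_dist1 b c
      have h3 : dist1 b c = 1 := hs.1
      show distInf 0 c ≤ L
      omega
    exact ⟨hz, hc, ih.2.2.tail ⟨hs.1, ih.2.1, hc⟩⟩

lemma not_badLoc_Sr {L : ℕ} {ω : Config d} (h : ω ∉ badLoc d L) : (0 : Pt d) ∈ Sr ω L := by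
  simp only [badLoc, Set.mem_ofPred_eq, not_forall, not_lt] at h
  obtain ⟨y, hy, hd⟩ := h
  have hy' := connIn_mono Set.inter_subset_left hy
  refine ⟨hy'.1, 0, ⟨hy'.1, hy'.1, .refl⟩, y, hy', ?_⟩
  exact_mod_cast hd.trans (distInf_le_dist1 0 y)

/-! ### From large clusters to infinite clusters -/

lemma Sr_anti {ω : Config d} {r s : ℝ} (h : s ≤ r) : Sr ω r ⊆ Sr ω s := by
  rintro x ⟨hx, y, hy, z, hz, hr⟩
  exact ⟨hx, y, hy, z, hz, h.trans hr⟩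

lemma Sr_conn {ω : Config d} {r : ℝ} {x y : Pt d} (h : connIn (SS ω) x y) (hy : y ∈ Sr ω r) :
    x ∈ Sr ω r := by
  obtain ⟨_, z, hz, w, hw, hr⟩ := hy
  exact ⟨h.1, z, connIn_trans h hz, w, connIn_trans h hw, hr⟩

/-- Failure of local uniqueness at some dyadic scale above `L`. -/
def badU (d L : ℕ) : Set (Config d) :=
  ⋃ j : ℕ, ((locUniq1 d (2 ^ j * L))ᶜ ∪ (locUniq2 d (2 ^ j * L))ᶜ)

lemma meas_badU (L : ℕ) : MeasurableSet (badU d L) :=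
  MeasurableSet.iUnion fun _ => (meas_locUniq1 _).compl.union (meas_locUniq2 _).compl

lemma Sr_Sinf {L : ℕ} (hL : 1 ≤ L) {ω : Config d} (h0 : (0 : Pt d) ∈ Sr ω L)
    (hU : ω ∉ badU d L) : (0 : Pt d) ∈ Sinf ω := by
  simp only [badU, Set.mem_iUnion, Set.mem_union, Set.mem_compl_iff, not_exists, not_or,
    not_not] at hU
  have H : ∀ j : ℕ, (0 : Pt d) ∈ Sr ω ((2 ^ j * L : ℕ) : ℝ) := by
    intro j
    induction j with
    | zero => simpa using h0
    | succ j ih =>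
      obtain ⟨⟨y, hy1, hy2⟩, h2⟩ := hU (j + 1)
      have hc := h2 0 ⟨Sr_anti (by
          push_cast
          have : (0 : ℝ) ≤ 2 ^ j * L := by positivity
          rw [pow_succ]
          linarith) ih, by simp [ballZ, distInf]⟩ y ⟨Sr_anti (by
          have : (0 : ℝ) ≤ ((2 ^ (j + 1) * L : ℕ) : ℝ) := by positivity
          linarith) hy1, hy2⟩
      exact Sr_conn (connIn_mono Set.inter_subset_left hc) hy1
  refine ⟨h0.1, fun hfin => ?_⟩
  have hfin2 := (hfin.prod hfin).image (fun p : Pt d × Pt d => dist1 p.1 p.2)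
  obtain ⟨B, hB⟩ := hfin2.bddAbove
  obtain ⟨_, y, hy, z, hz, hr⟩ := H (B + 1)
  have h1 : dist1 y z ≤ B := hB ⟨(y, z), ⟨hy, hz⟩, rfl⟩
  have h2 : 2 ^ (B + 1) * L ≤ dist1 y z := by exact_mod_cast hr
  have h3 : B + 1 < 2 ^ (B + 1) := Nat.lt_two_pow_self
  nlinarith

lemma shift_Sinf {x : Pt d} {ω : Config d} (h : (0 : Pt d) ∈ Sinf (shift x ω)) : x ∈ Sinf ω := by
  obtain ⟨h0, hinf⟩ := h
  have hm : ∀ y, y ∈ SS (shift x ω) → x + y ∈ SS ω := fun y hy => hy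
  have hx : x ∈ SS ω := by simpa using hm 0 h0
  refine ⟨hx, ?_⟩
  have hinf2 := hinf.image (f := fun y => x + y) (fun y _ z _ hyz => add_left_cancel hyz)
  refine hinf2.mono ?_
  rintro _ ⟨y, hy, rfl⟩
  refine ⟨hx, hm y hy.2.1, ?_⟩
  have := hy.2.2
  have h2 := Relation.ReflTransGen.lift (p := stepRel (SS ω)) (fun y => x + y) (by
    rintro a b ⟨h1, h2, h3⟩
    refine ⟨?_, hm _ h2, hm _ h3⟩
    unfold adj dist1 at *
    simpa using h1) _ _ this
  simpa [Function.onFun] using h2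

/-! ### Hierarchical events -/

/-- The hierarchical intersection of translates of `A0`. -/
def hier (A0 : Set (Config d)) (e : Pt d) (ρ L : ℕ) : ℕ → Pt d → Set (Config d)
  | 0, x => shift x ⁻¹' A0
  | n + 1, x => hier A0 e ρ L n x ∩ hier A0 e ρ L n (x + ((ρ ^ (n + 1) * L : ℕ) : ℤ) • e)

lemma hier_meas {A0 : Set (Config d)} (h : MeasurableSet A0) (e : Pt d) (ρ L n : ℕ) (x : Pt d) :
    MeasurableSet (hier A0 e ρ L n x) := by
  induction n generalizing x with
  | zero => exact meas_shift x h
  | succ n ih => exact (ih _).inter (ih _)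

lemma hier_dec {A0 : Set (Config d)} (h : DecreasingEvent A0) (e : Pt d) (ρ L n : ℕ) (x : Pt d) :
    DecreasingEvent (hier A0 e ρ L n x) := by
  induction n generalizing x with
  | zero =>
    intro ω ω' hω h1
    exact h _ _ (fun y hy => hω _ hy) h1
  | succ n ih => exact fun ω ω' hω h1 => ⟨ih _ _ _ hω h1.1, ih _ _ _ hω h1.2⟩

lemma hier_dep {L : ℕ} {A0 : Set (Config d)} (h : DependsOn A0 (ballZ 0 L)) (e : Pt d)
    (he : dist1 (0 : Pt d) e = 1) (ρ n : ℕ) (hρ : 2 ≤ ρ) (x : Pt d) :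
    DependsOn (hier A0 e ρ L n x) (ballZ x (10 * (ρ ^ n * L))) := by
  induction n generalizing x with
  | zero =>
    intro ω ω' hω
    refine h _ _ fun y hy => hω _ ?_
    have h1 := (distInf_le_iff 0 y L).1 hy
    show distInf _ _ ≤ _
    rw [distInf_le_iff]
    intro i
    have := h1 i
    simp at this ⊢
    omega
  | succ n ih =>
    intro ω ω' hω
    refine and_congr (ih _ _ _ fun y hy => hω y ?_) (ih _ _ _ fun y hy => hω y ?_)
    · have hy' : distInf x y ≤ 10 * (ρ ^ n * L) := hy
      show distInf x y ≤ 10 * (ρ ^ (n + 1) * L)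
      refine hy'.trans ?_
      rw [pow_succ]
      nlinarith [Nat.zero_le (ρ ^ n * L)]
    · have hy' : distInf _ y ≤ 10 * (ρ ^ n * L) := hy
      show distInf x y ≤ 10 * (ρ ^ (n + 1) * L)
      have h1 := distInf_shift_le x e he (ρ ^ (n + 1) * L)
      have h2 := distInf_triangle x (x + ((ρ ^ (n + 1) * L : ℕ) : ℤ) • e) y
      have h3 : 2 * (ρ ^ n * L) ≤ ρ ^ (n + 1) * L := by
        rw [pow_succ]
        nlinarith [Nat.zero_le (ρ ^ n * L)]
      omega

lemma hier_sub (A0 : Set (Config d)) (e : Pt d) (ρ L n : ℕ) (hρ : 2 ≤ ρ) (x : Pt d)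
    (ω : Config d) (h : ∀ k : ℕ, k ≤ 2 * (ρ ^ n * L) → shift (x + (k : ℤ) • e) ω ∈ A0) :
    ω ∈ hier A0 e ρ L n x := by
  induction n generalizing x with
  | zero =>
    have := h 0 (Nat.zero_le _)
    simp only [Nat.cast_zero, zero_smul, add_zero] at this
    exact this
  | succ n ih =>
    have h3 : 2 * (ρ ^ n * L) ≤ ρ ^ (n + 1) * L := by
      rw [pow_succ]
      nlinarith [Nat.zero_le (ρ ^ n * L)]
    refine ⟨ih x fun k hk => h k (by omega), ih _ fun k hk => ?_⟩
    have := h (ρ ^ (n + 1) * L + k) (by omega)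
    rw [Nat.cast_add, add_smul, ← add_assoc] at this
    exact this

/-! ### Probability estimates -/

lemma shift_real {a b : ℝ} {P : ℝ → Measure (Config d)} (Ax : Axioms d a b P) {u : ℝ}
    (hu : u ∈ Set.Ioo a b) (x : Pt d) {A : Set (Config d)} (hA : MeasurableSet A) :
    (P u).real (shift x ⁻¹' A) = (P u).real A := by
  by_cases hx : x = 0
  · subst hx
    congr 1
    ext ω
    have : shift (0 : Pt d) ω = ω := by
      funext y
      simp [shift]
    simp [this]
  · have := (Ax.ergodic u hu x hx).toMeasurePreserving.measure_preimage hA.nullMeasurableSet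
    simp only [Measure.real, this]

lemma badU_bound {a b : ℝ} {P : ℝ → Measure (Config d)} (Ax : Axioms d a b P) {u : ℝ}
    (hu : u ∈ Set.Ioo a b) {L : ℕ} (hL : Ax.RS u ≤ L) (hL3 : 3 ≤ L) :
    (P u).real (badU d L) ≤ 4 * Real.exp (-(Real.log L) ^ (1 + Ax.ΔS u)) := by
  have := Ax.prob u hu
  set Δ := Ax.ΔS u with hΔ
  have hΔpos : 0 < Δ := Ax.ΔS_pos u hu
  have hl1 : 1 ≤ Real.log L := by
    rw [Real.le_log_iff_exp_le (by positivity)]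
    have h3 : (3 : ℝ) ≤ L := by exact_mod_cast hL3
    linarith [Real.exp_one_lt_d9]
  set l := Real.log L with hl
  have key : ∀ j : ℕ, Real.exp (-(Ax.fS u (2 ^ j * L))) ≤
      Real.exp (-l ^ (1 + Δ)) * (1 / 2) ^ j := by
    intro j
    have hge : L ≤ 2 ^ j * L := Nat.le_mul_of_pos_left _ (by positivity)
    have h1 := Ax.fS_lb u hu (2 ^ j * L) (hL.trans hge)
    have hlog : Real.log ((2 ^ j * L : ℕ) : ℝ) = l + j * Real.log 2 := by
      push_cast
      rw [Real.log_mul (by positivity) (by positivity), Real.log_pow]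
      ring
    rw [hlog] at h1
    have hlog2 : 0 < Real.log 2 := Real.log_pos (by norm_num)
    have hs : 0 ≤ (j : ℝ) * Real.log 2 := by positivity
    have h2 : l ^ (1 + Δ) + j * Real.log 2 ≤ (l + j * Real.log 2) ^ (1 + Δ) := by
      rw [Real.rpow_add (by linarith), Real.rpow_add (by linarith), Real.rpow_one, Real.rpow_one]
      have h3 : l ^ Δ ≤ (l + j * Real.log 2) ^ Δ :=
        Real.rpow_le_rpow (by linarith) (by linarith) hΔpos.le
      have h4 : 1 ≤ l ^ Δ := Real.one_le_rpow hl1 hΔpos.le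
      nlinarith
    have h5 : ((1 : ℝ) / 2) ^ j = Real.exp (-(j * Real.log 2)) := by
      rw [Real.exp_neg, mul_comm, Real.exp_mul, Real.exp_log (by norm_num), Real.rpow_natCast]
      simp
    rw [h5, ← Real.exp_add]
    apply Real.exp_le_exp.2
    linarith
  have h1 : ∀ j : ℕ, P u ((locUniq1 d (2 ^ j * L))ᶜ ∪ (locUniq2 d (2 ^ j * L))ᶜ) ≤
      ENNReal.ofReal (2 * Real.exp (-l ^ (1 + Δ)) * (1 / 2) ^ j) := by
    intro j
    have hge : 1 ≤ 2 ^ j * L := by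
      have : L ≤ 2 ^ j * L := Nat.le_mul_of_pos_left _ (by positivity)
      omega
    have ha := Ax.S1a u hu _ hge
    have hb := Ax.S1b u hu _ hge
    have ha' := probReal_compl_eq_one_sub (μ := P u) (meas_locUniq1 (d := d) (2 ^ j * L))
    have hb' := probReal_compl_eq_one_sub (μ := P u) (meas_locUniq2 (d := d) (2 ^ j * L))
    have hc := measureReal_union_le (μ := P u) (locUniq1 d (2 ^ j * L))ᶜ (locUniq2 d (2 ^ j * L))ᶜ
    rw [← ofReal_measureReal]
    apply ENNReal.ofReal_le_ofReal
    have := key j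
    simp only [Measure.real] at *
    linarith
  have hsum : HasSum (fun j : ℕ => 2 * Real.exp (-l ^ (1 + Δ)) * (1 / 2 : ℝ) ^ j)
      (2 * Real.exp (-l ^ (1 + Δ)) * 2) := hasSum_geometric_two.mul_left _
  have h2 : P u (badU d L) ≤ ENNReal.ofReal (2 * Real.exp (-l ^ (1 + Δ)) * 2) := by
    refine (measure_iUnion_le _).trans ((ENNReal.tsum_le_tsum h1).trans ?_)
    rw [← hsum.tsum_eq, ENNReal.ofReal_tsum_of_nonneg (fun j => by positivity) hsum.summable]
  have h3 := ENNReal.toReal_mono ENNReal.ofReal_ne_top h2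
  rw [ENNReal.toReal_ofReal (by positivity)] at h3
  refine h3.trans (le_of_eq ?_)
  ring

lemma badLoc_bound {a b : ℝ} {P : ℝ → Measure (Config d)} (Ax : Axioms d a b P) {u : ℝ}
    (hu : u ∈ Set.Ioo a b) (L : ℕ) :
    (P u).real (badLoc d L) ≤ 1 - eta d (P u) := by
  have := Ax.prob u hu
  have h1 := probReal_compl_eq_one_sub (μ := P u) (meas_badLoc (d := d) L)
  have h2 : (P u).real {ω | (0 : Pt d) ∈ Sinf ω} ≤ (P u).real (badLoc d L)ᶜ :=
    measureReal_mono (fun ω h hb => badLoc_not_Sinf hb h)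
  have h3 : (P u).real {ω | (0 : Pt d) ∈ Sinf ω} = eta d (P u) := rfl
  linarith

/-- The multi-scale decoupling recursion. -/
lemma hier_bound {a b : ℝ} {P : ℝ → Measure (Config d)} (Ax : Axioms d a b P)
    {u v : ℝ} (hu : u ∈ Set.Ioo a b) (hv : v ∈ Set.Ioo a b) (hvu : v < u)
    {r : ℝ} (hr0 : 0 < r) (hr1 : r < 1) (hr : 1 - eta d (P v) ≤ r ^ 2)
    (e : Pt d) (he : dist1 (0 : Pt d) e = 1) (ρ L N : ℕ) (hN : 1 ≤ N) (hρ2 : 2 ≤ ρ)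
    (hρ : Ax.RP ≤ ρ) (hL : 1 ≤ L)
    (hspr : (ρ : ℝ) ^ (-Ax.χP) * u * N ≤ u - v)
    (hδ : ∀ n, n < N → Real.exp (-(Ax.fP (ρ ^ n * L))) ≤ (1 - r) * r ^ (1 + 2 ^ N)) :
    (P u).real (hier (badLoc d L) e ρ L N 0) ≤ r ^ (2 ^ N + 1) := by
  have hNpos : (0 : ℝ) < N := by exact_mod_cast hN
  set w : ℕ → ℝ := fun n => v + n * ((u - v) / N) with hw
  have hstep : 0 < (u - v) / N := div_pos (by linarith) hNpos
  have hwN : w N = u := by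
    simp only [hw]
    field_simp
    ring
  have hwmono : ∀ n m : ℕ, n ≤ m → w n ≤ w m := by
    intro n m h
    have : (n : ℝ) ≤ m := by exact_mod_cast h
    simp only [hw]
    nlinarith
  have hw0 : w 0 = v := by simp [hw]
  have hwmem : ∀ n, n ≤ N → w n ∈ Set.Ioo a b := by
    intro n hn
    have h1 := hwmono 0 n (Nat.zero_le _)
    have h2 := hwmono n N hn
    rw [hw0] at h1
    rw [hwN] at h2
    exact ⟨lt_of_lt_of_le hv.1 h1, lt_of_le_of_lt h2 hu.2⟩
  suffices H : ∀ n, n ≤ N → ∀ x, (P (w n)).real (hier (badLoc d L) e ρ L n x) ≤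
      r ^ (2 ^ n + 1) by
    have := H N le_rfl 0
    rwa [hwN] at this
  intro n
  induction n with
  | zero =>
    intro _ x
    rw [hw0]
    show (P v).real (shift x ⁻¹' badLoc d L) ≤ _
    rw [shift_real Ax hv x (meas_badLoc L)]
    have := badLoc_bound Ax hv L
    norm_num
    linarith
  | succ n ih =>
    intro hn x
    have ih' := ih (by omega)
    set x' := x + ((ρ ^ (n + 1) * L : ℕ) : ℤ) • e with hx'
    have hwn : w (n + 1) = w n + (u - v) / N := by
      simp only [hw]
      push_cast
      ring
    have hwu : w n ≤ u := by
      have := hwmono n N (by omega)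
      rwa [hwN] at this
    have hwv : v ≤ w n := by
      have := hwmono 0 n (Nat.zero_le _)
      rwa [hw0] at this
    have hLn : 1 ≤ ρ ^ n * L := Nat.mul_pos (by positivity) hL
    have hdec := Ax.decoupleDec ρ (ρ ^ n * L) hρ hLn x x' (by
        refine le_trans (le_of_eq ?_) (le_distInf_shift x e he (ρ ^ (n + 1) * L))
        ring)
      (w (n + 1)) (w n) (hwmem n (by omega)) (hwmem (n + 1) hn) (by linarith) (by
        have h1 : (ρ : ℝ) ^ (-Ax.χP) * u ≤ (u - v) / N := by
          rw [le_div_iff₀ hNpos]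
          exact hspr
        have h2 : (ρ : ℝ) ^ (-Ax.χP) * w n ≤ (ρ : ℝ) ^ (-Ax.χP) * u :=
          mul_le_mul_of_nonneg_left hwu (by positivity)
        rw [hwn]
        linarith)
      (hier (badLoc d L) e ρ L n x) (hier (badLoc d L) e ρ L n x')
      (hier_meas (meas_badLoc L) _ _ _ _ _) (hier_meas (meas_badLoc L) _ _ _ _ _)
      (hier_dec (dec_badLoc L) _ _ _ _ _) (hier_dec (dec_badLoc L) _ _ _ _ _)
      (hier_dep (dep_badLoc L) e he ρ n hρ2 x) (hier_dep (dep_badLoc L) e he ρ n hρ2 x')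
    have h1 := ih' x
    have h2 := ih' x'
    have h3 := hδ n (by omega)
    have h4 : r ^ (1 + 2 ^ N) ≤ r ^ (1 + 2 ^ (n + 1)) := by
      apply pow_le_pow_of_le_one hr0.le hr1.le
      have : 2 ^ (n + 1) ≤ 2 ^ N := Nat.pow_le_pow_right (by norm_num) hn
      omega
    have h5 : (P (w n)).real (hier (badLoc d L) e ρ L n x) *
        (P (w n)).real (hier (badLoc d L) e ρ L n x') ≤ r ^ (2 ^ n + 1) * r ^ (2 ^ n + 1) :=
      mul_le_mul h1 h2 measureReal_nonneg (by positivity)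
    have h6 : r ^ (2 ^ n + 1) * r ^ (2 ^ n + 1) = r * r ^ (1 + 2 ^ (n + 1)) := by
      rw [← pow_add, ← pow_succ']
      congr 1
      ring
    have h7 : (1 - r) * r ^ (1 + 2 ^ N) ≤ (1 - r) * r ^ (1 + 2 ^ (n + 1)) :=
      mul_le_mul_of_nonneg_left h4 (by linarith)
    have h8 : r ^ (2 ^ (n + 1) + 1) = r ^ (1 + 2 ^ (n + 1)) := by rw [add_comm]
    rw [h8]
    calc (P (w (n + 1))).real (hier (badLoc d L) e ρ L (n + 1) x)
        ≤ (P (w n)).real (hier (badLoc d L) e ρ L n x) *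
          (P (w n)).real (hier (badLoc d L) e ρ L n x') + Real.exp (-(Ax.fP (ρ ^ n * L))) := hdec
      _ ≤ r * r ^ (1 + 2 ^ (n + 1)) + (1 - r) * r ^ (1 + 2 ^ (n + 1)) := by linarith
      _ = r ^ (1 + 2 ^ (n + 1)) := by ring

/-- Combining the recursion with local uniqueness. -/
lemma final_bound {a b : ℝ} {P : ℝ → Measure (Config d)} (Ax : Axioms d a b P)
    {u : ℝ} (hu : u ∈ Set.Ioo a b) (e : Pt d) (ρ L N R : ℕ) (hρ2 : 2 ≤ ρ)
    (hL : 3 ≤ L) (hLS : Ax.RS u ≤ L) (hR : 2 * (ρ ^ N * L) ≤ R) :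
    1 - ((P u).real (hier (badLoc d L) e ρ L N 0) +
        (R + 1) * (4 * Real.exp (-(Real.log L) ^ (1 + Ax.ΔS u)))) ≤
      (P u {ω | ∃ k : ℕ, k ≤ R ∧ ((k : ℤ) • e) ∈ Sinf ω}).toReal := by
  have := Ax.prob u hu
  set F := {ω : Config d | ∃ k : ℕ, k ≤ R ∧ ((k : ℤ) • e) ∈ Sinf ω} with hF
  set V := ⋃ k ∈ Finset.range (R + 1), shift ((k : ℤ) • e) ⁻¹' badU d L with hV
  have hcov : (Set.univ : Set (Config d)) ⊆ F ∪ (hier (badLoc d L) e ρ L N 0 ∪ V) := by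
    intro ω _
    by_cases h1 : ω ∈ F
    · exact Or.inl h1
    by_cases h2 : ω ∈ V
    · exact Or.inr (Or.inr h2)
    refine Or.inr (Or.inl (hier_sub _ e ρ L N hρ2 0 ω fun k hk => ?_))
    by_contra h3
    apply h1
    refine ⟨k, hk.trans hR, ?_⟩
    rw [zero_add] at h3
    apply shift_Sinf
    refine Sr_Sinf (by omega) (not_badLoc_Sr h3) fun h4 => h2 ?_
    simp only [hV, Set.mem_iUnion]
    exact ⟨k, Finset.mem_range.2 (by omega), h4⟩
  have h1 : (1 : ℝ) ≤ (P u).real (F ∪ (hier (badLoc d L) e ρ L N 0 ∪ V)) := by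
    rw [← probReal_univ (μ := P u)]
    exact measureReal_mono hcov
  have h2 := measureReal_union_le (μ := P u) F (hier (badLoc d L) e ρ L N 0 ∪ V)
  have h3 := measureReal_union_le (μ := P u) (hier (badLoc d L) e ρ L N 0) V
  have h4 : (P u).real V ≤ (R + 1) * (4 * Real.exp (-(Real.log L) ^ (1 + Ax.ΔS u))) := by
    refine (measureReal_biUnion_finset_le _ _).trans ?_
    refine (Finset.sum_le_card_nsmul _ _ (4 * Real.exp (-(Real.log L) ^ (1 + Ax.ΔS u)))
      fun k _ => ?_).trans (le_of_eq ?_)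
    · rw [shift_real Ax hu _ (meas_badU L)]
      exact badU_bound Ax hu hLS hL
    · simp
  show _ ≤ (P u).real F
  linarith

/-! ### Asymptotics -/

lemma asymp (A B q c : ℝ) (hq : 1 < q) (hc : 0 < c) :
    ∀ᶠ m : ℕ in atTop, A * (m : ℝ) ^ 2 + B ≤ c * q ^ m := by
  have h1 := (isLittleO_pow_const_const_pow_of_one_lt (R := ℝ) 2 hq).const_mul_left A
  have h2 := (isLittleO_pow_const_const_pow_of_one_lt (R := ℝ) 0 hq).const_mul_left B
  have h3 := (h1.add h2).bound hc
  filter_upwards [h3] with m hm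
  have h4 : 0 ≤ q ^ m := by positivity
  rw [Real.norm_eq_abs, Real.norm_of_nonneg h4] at hm
  simp only [pow_zero, mul_one] at hm
  exact (le_abs_self _).trans hm

lemma tendsto_natLog : Tendsto (fun n : ℕ => Nat.log 2 n) atTop atTop := by
  refine tendsto_atTop.2 fun b => ?_
  filter_upwards [eventually_ge_atTop (2 ^ b)] with n hn
  exact Nat.le_log_of_pow_le (by norm_num) hn

lemma asymp_e (K : ℕ) (ε r : ℝ) (hε : 0 < ε) (hr0 : 0 < r) (hr1 : r < 1) :
    ∀ᶠ m : ℕ in atTop, ∀ h : ℝ, (2 : ℝ) ^ m * (Real.log 2 / 4) ≤ h →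
      Real.exp (-Real.exp (h ^ ε)) ≤ (1 - r) * r ^ (1 + 2 ^ (K * (m + 1))) := by
  set G := -Real.log (1 - r) with hG
  set lam := -Real.log r with hlam
  have hGpos : 0 < G := by
    have := Real.log_neg (x := 1 - r) (by linarith) (by linarith)
    linarith
  have hlpos : 0 < lam := by
    have := Real.log_neg hr0 hr1
    linarith
  have hlog2 : 0 < Real.log 2 := Real.log_pos (by norm_num)
  have h2ε : 1 < (2 : ℝ) ^ ε := Real.one_lt_rpow (by norm_num) hε
  filter_upwards [asymp (K * Real.log 2) (Real.log (G + 2 * lam) + K * Real.log 2) ((2 : ℝ) ^ ε)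
    ((Real.log 2 / 4) ^ ε) h2ε (by positivity)] with m hm h hh
  have hm1 : (m : ℝ) ≤ (m : ℝ) ^ 2 := by exact_mod_cast Nat.le_self_pow (by norm_num) m
  have h1 : (Real.log 2 / 4) ^ ε * ((2 : ℝ) ^ ε) ^ m ≤ h ^ ε := by
    have : ((2 : ℝ) ^ ε) ^ m = ((2 : ℝ) ^ m) ^ ε := by
      rw [← Real.rpow_natCast, ← Real.rpow_natCast, ← Real.rpow_mul (by norm_num),
        ← Real.rpow_mul (by norm_num), mul_comm]
    rw [this, ← Real.mul_rpow (by positivity) (by positivity), mul_comm]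
    exact Real.rpow_le_rpow (by positivity) hh hε.le
  have h2 : Real.log (G + 2 * lam) + (K * (m + 1) : ℕ) * Real.log 2 ≤ h ^ ε := by
    refine le_trans ?_ (hm.trans h1)
    push_cast
    have : (K : ℝ) * Real.log 2 * m ≤ K * Real.log 2 * (m : ℝ) ^ 2 :=
      mul_le_mul_of_nonneg_left hm1 (by positivity)
    linarith
  have h3 : (G + 2 * lam) * 2 ^ (K * (m + 1)) ≤ Real.exp (h ^ ε) := by
    refine le_trans (le_of_eq ?_) (Real.exp_le_exp.2 h2)
    rw [Real.exp_add, Real.exp_log (by positivity), mul_comm ((K * (m + 1) : ℕ) : ℝ), Real.exp_mul,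
      Real.exp_log (by norm_num), Real.rpow_natCast]
  have h4 : (1 : ℝ) ≤ 2 ^ (K * (m + 1)) := one_le_pow₀ (by norm_num)
  have h5 : (1 - r) * r ^ (1 + 2 ^ (K * (m + 1))) =
      Real.exp (-(G + (1 + 2 ^ (K * (m + 1))) * lam)) := by
    have : -(G + (1 + 2 ^ (K * (m + 1))) * lam) =
        Real.log (1 - r) + Real.log r * ((1 + 2 ^ (K * (m + 1)) : ℕ) : ℝ) := by
      push_cast
      simp only [hG, hlam]
      ring
    rw [this, Real.exp_add, Real.exp_log (by linarith), Real.exp_mul, Real.exp_log hr0,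
      Real.rpow_natCast]
  rw [h5]
  apply Real.exp_le_exp.2
  have h6 : 0 ≤ (G + lam) * ((2 : ℝ) ^ (K * (m + 1)) - 1) :=
    mul_nonneg (by positivity) (by linarith)
  nlinarith

set_option maxHeartbeats 1000000 in
lemma main_eventually {a b : ℝ} (ha : 0 ≤ a) {P : ℝ → Measure (Config d)} (Ax : Axioms d a b P)
    {u : ℝ} (hu : u ∈ Set.Ioo a b) :
    ∃ c > (0 : ℝ), ∀ᶠ R : ℕ in atTop, ∀ e : Pt d, dist1 (0 : Pt d) e = 1 →
      1 - 9 * Real.exp (-c * (Real.log R) ^ (1 + Ax.ΔS u)) ≤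
        (P u {ω | ∃ k : ℕ, k ≤ R ∧ ((k : ℤ) • e) ∈ Sinf ω}).toReal := by
  set Δ := Ax.ΔS u with hΔ
  have hΔpos : 0 < Δ := Ax.ΔS_pos u hu
  obtain ⟨v, hav, hvu⟩ := exists_between hu.1
  have hv : v ∈ Set.Ioo a b := ⟨hav, hvu.trans hu.2⟩
  have hupos : 0 < u := lt_of_le_of_lt ha hu.1
  have := Ax.prob v hv
  have hηpos := Ax.S2pos v hv
  have hη1 : eta d (P v) ≤ 1 := by
    have : (P v).real {ω | (0 : Pt d) ∈ Sinf ω} ≤ 1 := measureReal_le_one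
    exact this
  obtain ⟨r, hrdef⟩ : ∃ r, r = 1 - eta d (P v) / 2 := ⟨_, rfl⟩
  have hr0 : 0 < r := by linarith
  have hr1 : r < 1 := by linarith
  have hr : 1 - eta d (P v) ≤ r ^ 2 := by
    rw [hrdef]
    nlinarith [sq_nonneg (eta d (P v))]
  obtain ⟨lam, hlam⟩ : ∃ lam, lam = -Real.log r := ⟨_, rfl⟩
  have hlpos : 0 < lam := by
    have := Real.log_neg hr0 hr1
    linarith
  obtain ⟨K, hK⟩ : ∃ K : ℕ, 1 + Δ ≤ K := exists_nat_ge _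
  have hK1 : 1 ≤ K := by
    have : (1 : ℝ) ≤ K := by linarith
    exact_mod_cast this
  have hlog2 : 0 < Real.log 2 := Real.log_pos (by norm_num)
  have hlog2' : Real.log 2 ≤ 1 := by linarith [Real.log_two_lt_d9]
  obtain ⟨c0, hc0⟩ : ∃ c0 : ℝ, c0 = (1 / 4 : ℝ) ^ (1 + Δ) / 2 := ⟨_, rfl⟩
  have hc0pos : 0 < c0 := by
    rw [hc0]
    positivity
  have h2χ : 1 < (2 : ℝ) ^ Ax.χP := Real.one_lt_rpow (by norm_num) Ax.χP_pos
  have hM := tendsto_natLog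
  have hm := tendsto_natLog.comp tendsto_natLog
  have ht : Tendsto (fun R : ℕ => Real.log (R : ℝ)) atTop atTop :=
    Real.tendsto_log_atTop.comp tendsto_natCast_atTop_atTop
  refine ⟨min lam c0, lt_min hlpos hc0pos, ?_⟩
  filter_upwards [hm.eventually (asymp (K * u) (K * u) ((2 : ℝ) ^ Ax.χP) (u - v) h2χ (by linarith)),
    hm.eventually (asymp (4 * K) 2 2 1 (by norm_num) (by norm_num)),
    hm.eventually (asymp_e K Ax.εP r Ax.εP_pos hr0 hr1),
    hm.eventually (eventually_ge_atTop (Ax.RP + 1)),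
    hM.eventually (eventually_ge_atTop (2 * (Ax.LP + Ax.RS u + 3))),
    ht.eventually (eventually_ge_atTop 1),
    ((tendsto_rpow_atTop hΔpos).comp ht).eventually (eventually_ge_atTop (1 / c0)),
    eventually_ge_atTop 1] with R hb hc he4 hRP hMbig ht1 htΔ hR1 e he
  simp only [Function.comp_apply] at hb hc he4 hRP htΔ
  obtain ⟨M, hMdef⟩ : ∃ M, M = Nat.log 2 R := ⟨_, rfl⟩
  rw [← hMdef] at hb hc he4 hRP hMbig
  obtain ⟨m, hmdef⟩ : ∃ m, m = Nat.log 2 M := ⟨_, rfl⟩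
  rw [← hmdef] at hb hc he4 hRP
  have hMR : 2 ^ M ≤ R := by
    rw [hMdef]
    exact Nat.pow_log_le_self 2 (by omega)
  have hRM : R < 2 ^ (M + 1) := by
    rw [hMdef]
    exact Nat.lt_pow_succ_log_self (by norm_num) R
  have hmM : 2 ^ m ≤ M := by
    rw [hmdef]
    exact Nat.pow_log_le_self 2 (by omega)
  have hMm : M < 2 ^ (m + 1) := by
    rw [hmdef]
    exact Nat.lt_pow_succ_log_self (by norm_num) M
  have hm1 : (m : ℝ) ≤ (m : ℝ) ^ 2 := by exact_mod_cast Nat.le_self_pow (by norm_num) m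
  have hm2 : m < 2 ^ m := Nat.lt_two_pow_self
  have hLbig : M / 2 < 2 ^ (M / 2) := Nat.lt_two_pow_self
  obtain ⟨L, hL⟩ : ∃ L, L = 2 ^ (M / 2) := ⟨_, rfl⟩
  rw [← hL] at hLbig
  have hlogL : Real.log L = ((M / 2 : ℕ) : ℝ) * Real.log 2 := by
    rw [hL]
    push_cast
    rw [Real.log_pow]
  have hMhalf : ((M : ℝ) + 1) / 4 ≤ ((M / 2 : ℕ) : ℝ) := by
    have : M + 1 ≤ 4 * (M / 2) := by omega
    have : ((M : ℝ) + 1) ≤ 4 * ((M / 2 : ℕ) : ℝ) := by exact_mod_cast this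
    linarith
  have htM : Real.log R ≤ (M + 1) * Real.log 2 := by
    have h1 : (R : ℝ) ≤ 2 ^ (M + 1) := by exact_mod_cast hRM.le
    have h2 := Real.log_le_log (by exact_mod_cast hR1) h1
    rw [Real.log_pow] at h2
    exact_mod_cast h2
  have hlogLlow : (2 : ℝ) ^ m * (Real.log 2 / 4) ≤ Real.log L := by
    have h1 : (2 : ℝ) ^ m ≤ M := by exact_mod_cast hmM
    rw [hlogL]
    have h0 := mul_le_mul_of_nonneg_right hMhalf hlog2.le
    have h2 := mul_le_mul_of_nonneg_right h1 hlog2.le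
    linarith
  have hA := hier_bound Ax hu hv hvu hr0 hr1 hr e he (2 ^ m) L (K * (m + 1))
    (Nat.mul_pos hK1 (Nat.succ_pos _)) (by
      have : 2 ^ 1 ≤ 2 ^ m := Nat.pow_le_pow_right (by norm_num) (by omega)
      omega) (by omega) (by omega) (by
      have h1 : ((2 ^ m : ℕ) : ℝ) ^ (-Ax.χP) = (((2 : ℝ) ^ Ax.χP) ^ m)⁻¹ := by
        rw [Real.rpow_neg (by positivity)]
        congr 1
        push_cast
        rw [← Real.rpow_natCast, ← Real.rpow_natCast, ← Real.rpow_mul (by norm_num),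
          ← Real.rpow_mul (by norm_num), mul_comm]
      rw [h1, mul_assoc, inv_mul_le_iff₀ (by positivity)]
      push_cast
      have : (K : ℝ) * u * m ≤ K * u * (m : ℝ) ^ 2 :=
        mul_le_mul_of_nonneg_left hm1 (by positivity)
      linarith) (by
      intro n _
      have hge : L ≤ (2 ^ m) ^ n * L := Nat.le_mul_of_pos_left _ (by positivity)
      have h1 := Ax.fP_lb ((2 ^ m) ^ n * L) (by omega)
      have hLpos : (0 : ℝ) < L := by
        have : 0 < L := by omega
        exact_mod_cast this
      have h2 := he4 (Real.log (((2 ^ m) ^ n * L : ℕ) : ℝ)) (hlogLlow.trans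
        (Real.log_le_log hLpos (by exact_mod_cast hge)))
      refine le_trans (Real.exp_le_exp.2 ?_) h2
      linarith)
  have hB := final_bound Ax hu e (2 ^ m) L (K * (m + 1)) R (by
      have : 2 ^ 1 ≤ 2 ^ m := Nat.pow_le_pow_right (by norm_num) (by omega)
      omega) (by omega) (by omega) (by
      refine le_trans ?_ hMR
      have : 2 * ((2 ^ m) ^ (K * (m + 1)) * L) = 2 ^ (1 + m * (K * (m + 1)) + M / 2) := by
        rw [hL, ← pow_mul, pow_add, pow_add]
        ring
      rw [this]
      apply Nat.pow_le_pow_right (by norm_num)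
      have h1 : 4 * K * m ^ 2 + 2 ≤ 2 ^ m := by
        have : (4 : ℝ) * K * m ^ 2 + 2 ≤ 2 ^ m := by linarith
        exact_mod_cast this
      have h2 : m * (K * (m + 1)) ≤ 2 * (K * m ^ 2) := by
        have : m ≤ m ^ 2 := Nat.le_self_pow (by norm_num) m
        calc m * (K * (m + 1)) = K * (m ^ 2 + m) := by ring
          _ ≤ K * (m ^ 2 + m ^ 2) := Nat.mul_le_mul_left _ (by omega)
          _ = 2 * (K * m ^ 2) := by ring
      have h3 : 4 * K * m ^ 2 = 4 * (K * m ^ 2) := by ring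
      omega)
  obtain ⟨t, htdef⟩ : ∃ t, t = Real.log (R : ℝ) := ⟨_, rfl⟩
  rw [← htdef] at htM ht1 htΔ ⊢
  have htpos : 0 < t := by linarith
  set T := t ^ (1 + Δ) with hT
  have hTpos : 0 < T := by positivity
  -- the hierarchical term
  have hE1 : r ^ (2 ^ (K * (m + 1)) + 1) ≤ Real.exp (-lam * T) := by
    have h1 : t ≤ (2 : ℝ) ^ (m + 1) := by
      have h2 : (M : ℝ) + 1 ≤ 2 ^ (m + 1) := by exact_mod_cast hMm
      have h0 : ((M : ℝ) + 1) * Real.log 2 ≤ ((M : ℝ) + 1) * 1 :=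
        mul_le_mul_of_nonneg_left hlog2' (by positivity)
      linarith
    have h3 : T ≤ 2 ^ (K * (m + 1)) := by
      calc T ≤ ((2 : ℝ) ^ (m + 1)) ^ (1 + Δ) := Real.rpow_le_rpow htpos.le h1 (by linarith)
        _ ≤ ((2 : ℝ) ^ (m + 1)) ^ (K : ℝ) :=
          Real.rpow_le_rpow_of_exponent_le (one_le_pow₀ (by norm_num)) hK
        _ = 2 ^ (K * (m + 1)) := by
          rw [Real.rpow_natCast, ← pow_mul, mul_comm]
    have h4 : r ^ (2 ^ (K * (m + 1)) + 1) ≤ r ^ (2 ^ (K * (m + 1))) :=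
      pow_le_pow_of_le_one hr0.le hr1.le (by omega)
    have h5 : r ^ (2 ^ (K * (m + 1))) = Real.exp (-lam * 2 ^ (K * (m + 1))) := by
      have : -lam * (2 : ℝ) ^ (K * (m + 1)) =
          Real.log r * ((2 ^ (K * (m + 1)) : ℕ) : ℝ) := by
        push_cast
        rw [hlam]
        ring
      rw [this, Real.exp_mul, Real.exp_log hr0, Real.rpow_natCast]
    rw [h5] at h4
    refine h4.trans (Real.exp_le_exp.2 ?_)
    have h6 := mul_le_mul_of_nonneg_left h3 hlpos.le
    rw [neg_mul, neg_mul]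
    exact neg_le_neg h6
  -- the local uniqueness term
  have hE2 : ((R : ℝ) + 1) * (4 * Real.exp (-(Real.log L) ^ (1 + Δ))) ≤
      8 * Real.exp (-c0 * T) := by
    have h1 : 2 * c0 * T ≤ (Real.log L) ^ (1 + Δ) := by
      have : 2 * c0 * T = (1 / 4 * t) ^ (1 + Δ) := by
        rw [Real.mul_rpow (by norm_num) htpos.le, hc0]
        ring
      rw [this]
      apply Real.rpow_le_rpow (by positivity) _ (by linarith)
      rw [hlogL]
      have h0 := mul_le_mul_of_nonneg_right hMhalf hlog2.le
      linarith
    have h2 : t ≤ c0 * T := by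
      have h3 : T = t * t ^ Δ := by
        rw [hT, Real.rpow_add htpos, Real.rpow_one]
      have h4 : 1 ≤ c0 * t ^ Δ := by
        rw [div_le_iff₀ hc0pos] at htΔ
        linarith
      rw [h3]
      have h0 := mul_le_mul_of_nonneg_left h4 htpos.le
      linarith
    have hR0 : (1 : ℝ) ≤ R := by exact_mod_cast hR1
    have h5 : (R : ℝ) = Real.exp t := by
      rw [htdef, Real.exp_log (by linarith)]
    calc ((R : ℝ) + 1) * (4 * Real.exp (-(Real.log L) ^ (1 + Δ)))
        ≤ (2 * R) * (4 * Real.exp (-(2 * c0 * T))) := by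
          apply mul_le_mul (by linarith) _ (by positivity) (by positivity)
          have := Real.exp_le_exp.2 (neg_le_neg h1)
          linarith
      _ = 8 * Real.exp (t - 2 * c0 * T) := by
          rw [sub_eq_add_neg, Real.exp_add, ← h5]
          ring
      _ ≤ 8 * Real.exp (-c0 * T) := by
          have := Real.exp_le_exp.2 (show t - 2 * c0 * T ≤ -c0 * T by linarith)
          linarith
  have hE3 : Real.exp (-lam * T) ≤ Real.exp (-(min lam c0) * T) := by
    apply Real.exp_le_exp.2
    have := mul_le_mul_of_nonneg_right (min_le_left lam c0) hTpos.le
    linarith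
  have hE4 : Real.exp (-c0 * T) ≤ Real.exp (-(min lam c0) * T) := by
    apply Real.exp_le_exp.2
    have := mul_le_mul_of_nonneg_right (min_le_right lam c0) hTpos.le
    linarith
  refine le_trans ?_ hB
  linarith

/-- Under P1–P3 and S1–S2, each `P^u` satisfies assumption A3 (with
`Δ₃ = Δ_S(u)`): points of the infinite cluster are found along every coordinate ray with
stretched-exponentially high probability. -/
theorem stmt15 (d : ℕ) (hd : 2 ≤ d) (a b : ℝ) (ha : 0 ≤ a) (hab : a < b)
    (P : ℝ → Measure (Config d)) (Ax : Axioms d a b P) :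
    ∀ u ∈ Set.Ioo a b,
      ∃ c > (0:ℝ), ∃ C : ℝ, 0 < C ∧
        ∀ R : ℕ, 1 ≤ R → ∀ e : Pt d, dist1 (0 : Pt d) e = 1 →
          1 - C * Real.exp (-c * (Real.log R) ^ (1 + Ax.ΔS u)) ≤
            (P u {ω | ∃ k : ℕ, k ≤ R ∧ ((k : ℤ) • e) ∈ Sinf ω}).toReal := by
  intro u hu
  obtain ⟨c, hc, hev⟩ := main_eventually ha Ax hu
  obtain ⟨R0, hR0⟩ := eventually_atTop.1 hev
  have hΔ := Ax.ΔS_pos u hu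
  refine ⟨c, hc, max 9 (Real.exp (c * (Real.log R0) ^ (1 + Ax.ΔS u))),
    lt_of_lt_of_le (by norm_num) (le_max_left _ _), ?_⟩
  intro R hR e he
  by_cases h : R0 ≤ R
  · refine le_trans ?_ (hR0 R h e he)
    have h1 := le_max_left (9 : ℝ) (Real.exp (c * (Real.log R0) ^ (1 + Ax.ΔS u)))
    have h2 := mul_le_mul_of_nonneg_right h1
      (Real.exp_pos (-c * (Real.log R) ^ (1 + Ax.ΔS u))).le
    linarith
  · refine le_trans ?_ ENNReal.toReal_nonneg
    have h1 := le_max_right (9 : ℝ) (Real.exp (c * (Real.log R0) ^ (1 + Ax.ΔS u)))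
    have h2 := mul_le_mul_of_nonneg_right h1
      (Real.exp_pos (-c * (Real.log R) ^ (1 + Ax.ΔS u))).le
    have hR1 : (1 : ℝ) ≤ R := by exact_mod_cast hR
    have hRR : (R : ℝ) ≤ R0 := by exact_mod_cast (not_le.1 h).le
    have h3 : (Real.log R) ^ (1 + Ax.ΔS u) ≤ (Real.log R0) ^ (1 + Ax.ΔS u) :=
      Real.rpow_le_rpow (Real.log_nonneg hR1) (Real.log_le_log (by linarith) hRR) (by linarith)
    rw [← Real.exp_add] at h2
    have h4 : 1 ≤ Real.exp (c * (Real.log R0) ^ (1 + Ax.ΔS u) +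
        -c * (Real.log R) ^ (1 + Ax.ΔS u)) := by
      apply Real.one_le_exp
      nlinarith
    linarith

end Perco
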